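/- arXiv:2407.05229 — 6 statements merged into one kernel-verified Lean document; each statement's English description precedes it below -/
import Mathlib

section
/- Let μ be a probability measure on a measurable space α and let w, τ, a : α → ℝ be measurable functions with 0 < w x ≤ 1, 0 < τ x ≤ 1 and 0 < a x ≤ 1 for all x. Assume x ↦ −log(w x), x ↦ −log(τ x) and x ↦ −log(a x) are integrable with ∫ −log(w x) dμ ≤ δ, ∫ −log(τ x) dμ ≤ ε and ∫ −log(a x) dμ ≤ η. Then the loss error L = max{∫ −log(w x · τ x) dμ, ∫ −log(a x) dμ} satisfies 0 ≤ L ≤ max{δ + ε, η}. -/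
open MeasureTheory Real

/-- Theorem 1 (CIL sufficiency): if the expected WTP, TII and TAP cross-entropies are
bounded by δ, ε and η respectively, then the CIL loss error
L = max{∫ −log(w·τ), ∫ −log a} satisfies 0 ≤ L ≤ max{δ+ε, η}. -/
theorem cil_sufficiency
    {α : Type*} [MeasurableSpace α] (μ : Measure α) [IsProbabilityMeasure μ]
    (w τ a : α → ℝ) (hw : Measurable w) (hτ : Measurable τ) (ha : Measurable a)
    (hw01 : ∀ x, 0 < w x ∧ w x ≤ 1)
    (hτ01 : ∀ x, 0 < τ x ∧ τ x ≤ 1)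
    (ha01 : ∀ x, 0 < a x ∧ a x ≤ 1)
    (δ ε η : ℝ)
    (hwInt : Integrable (fun x => -Real.log (w x)) μ)
    (hτInt : Integrable (fun x => -Real.log (τ x)) μ)
    (haInt : Integrable (fun x => -Real.log (a x)) μ)
    (hwB : ∫ x, -Real.log (w x) ∂μ ≤ δ)
    (hτB : ∫ x, -Real.log (τ x) ∂μ ≤ ε)
    (haB : ∫ x, -Real.log (a x) ∂μ ≤ η) :
    0 ≤ max (∫ x, -Real.log (w x * τ x) ∂μ) (∫ x, -Real.log (a x) ∂μ) ∧
      max (∫ x, -Real.log (w x * τ x) ∂μ) (∫ x, -Real.log (a x) ∂μ) ≤ max (δ + ε) η := by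
  have h : ∫ x, -Real.log (w x * τ x) ∂μ
      = (∫ x, -Real.log (w x) ∂μ) + ∫ x, -Real.log (τ x) ∂μ := by
    rw [← integral_add hwInt hτInt]
    refine integral_congr_ae (Filter.Eventually.of_forall fun x => ?_)
    change -Real.log (w x * τ x) = -Real.log (w x) + -Real.log (τ x)
    rw [Real.log_mul (hw01 x).1.ne' (hτ01 x).1.ne']
    ring
  constructor
  · refine le_max_of_le_right (integral_nonneg fun x => ?_)
    exact neg_nonneg.mpr (Real.log_nonpos (ha01 x).1.le (ha01 x).2)
  · rw [h]
    exact max_le_max (add_le_add hwB hτB) haB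
end

section
/- Let μ be a probability measure on a measurable space α and let w, τ, a : α → ℝ be measurable functions with 0 < w x ≤ 1, 0 < τ x ≤ 1 and 0 < a x ≤ 1 for all x. Assume x ↦ −log(w x · τ x) and x ↦ −log(a x) are integrable and that the loss error satisfies max{∫ −log(w x · τ x) dμ, ∫ −log(a x) dμ} ≤ ξ. Then x ↦ −log(w x) and x ↦ −log(τ x) are integrable, and ∫ −log(w x) dμ ≤ ξ, ∫ −log(τ x) dμ ≤ ξ and ∫ −log(a x) dμ ≤ ξ. -/
open MeasureTheory Real

/-- Theorem 2 (CIL necessity): if the CIL loss error max{∫ −log(w·τ), ∫ −log a} ≤ ξ,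
then the WTP, TII and TAP cross-entropies are integrable (where needed) and each
expected cross-entropy is bounded by ξ. -/
theorem cil_necessity
    {α : Type*} [MeasurableSpace α] (μ : Measure α) [IsProbabilityMeasure μ]
    (w τ a : α → ℝ) (hw : Measurable w) (hτ : Measurable τ) (ha : Measurable a)
    (hw01 : ∀ x, 0 < w x ∧ w x ≤ 1)
    (hτ01 : ∀ x, 0 < τ x ∧ τ x ≤ 1)
    (ha01 : ∀ x, 0 < a x ∧ a x ≤ 1)
    (ξ : ℝ)
    (hwτInt : Integrable (fun x => -Real.log (w x * τ x)) μ)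
    (haInt : Integrable (fun x => -Real.log (a x)) μ)
    (hL : max (∫ x, -Real.log (w x * τ x) ∂μ) (∫ x, -Real.log (a x) ∂μ) ≤ ξ) :
    Integrable (fun x => -Real.log (w x)) μ ∧
      Integrable (fun x => -Real.log (τ x)) μ ∧
      (∫ x, -Real.log (w x) ∂μ) ≤ ξ ∧
      (∫ x, -Real.log (τ x) ∂μ) ≤ ξ ∧
      (∫ x, -Real.log (a x) ∂μ) ≤ ξ := by
  have hlog : ∀ x, Real.log (w x * τ x) = Real.log (w x) + Real.log (τ x) := fun x =>
    Real.log_mul (hw01 x).1.ne' (hτ01 x).1.ne'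
  have hwn : ∀ x, Real.log (w x) ≤ 0 := fun x => Real.log_nonpos (hw01 x).1.le (hw01 x).2
  have hτn : ∀ x, Real.log (τ x) ≤ 0 := fun x => Real.log_nonpos (hτ01 x).1.le (hτ01 x).2
  have h1 : ∀ x, -Real.log (w x) ≤ -Real.log (w x * τ x) := fun x => by
    linarith [hlog x, hτn x]
  have h2 : ∀ x, -Real.log (τ x) ≤ -Real.log (w x * τ x) := fun x => by
    linarith [hlog x, hwn x]
  have i1 : Integrable (fun x => -Real.log (w x)) μ := by
    refine hwτInt.mono' hw.log.neg.aestronglyMeasurable (Filter.Eventually.of_forall fun x => ?_)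
    rw [Real.norm_of_nonneg (by linarith [hwn x])]
    exact h1 x
  have i2 : Integrable (fun x => -Real.log (τ x)) μ := by
    refine hwτInt.mono' hτ.log.neg.aestronglyMeasurable (Filter.Eventually.of_forall fun x => ?_)
    rw [Real.norm_of_nonneg (by linarith [hτn x])]
    exact h2 x
  have hA := (le_max_left _ _).trans hL
  exact ⟨i1, i2, (integral_mono i1 hwτInt h1).trans hA, (integral_mono i2 hwτInt h2).trans hA,
    (le_max_right _ _).trans hL⟩
end

section
/- Fix t ≥ 1, a ground-truth task index ī ∈ Fin t, OOD probabilities P : Fin t → ℝ and thresholds ε : Fin t → ℝ. Assume 0 < P ī, 0 ≤ P j for all j, exp(−ε ī) ≤ P ī (i.e. the ground-truth OOD cross-entropy −log(P ī) ≤ ε ī), and P j ≤ 1 − exp(−ε j) for every j ≠ ī (i.e. −log(1 − P j) ≤ ε j for j ≠ ī). Then the TII cross-entropy satisfies −log(P ī / ∑_{j} P j) ≤ exp(ε ī) · ∑_{j ≠ ī} (1 − exp(−ε j)). -/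
open Real Finset

/-- Theorem 3, first direction: if the OOD cross-entropies are bounded by ε i
(i.e. exp(−ε i₀) ≤ P i₀ for the ground-truth task and P j ≤ 1 − exp(−ε j) otherwise),
then the TII cross-entropy −log(P i₀ / ∑ j, P j) is bounded by
exp(ε i₀) · ∑_{j ≠ i₀} (1 − exp(−ε j)). -/
theorem ood_to_tii
    (t : ℕ) (ht : 1 ≤ t) (i₀ : Fin t) (P ε : Fin t → ℝ)
    (hPi₀ : 0 < P i₀) (hP : ∀ j, 0 ≤ P j)
    (hOODi₀ : Real.exp (-ε i₀) ≤ P i₀)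
    (hOOD : ∀ j, j ≠ i₀ → P j ≤ 1 - Real.exp (-ε j)) :
    -Real.log (P i₀ / ∑ j, P j) ≤
      Real.exp (ε i₀) * ∑ j ∈ Finset.univ.filter (fun j => j ≠ i₀), (1 - Real.exp (-ε j)) := by
  have hsplit : ∑ j, P j = P i₀ + ∑ j ∈ Finset.univ.filter (fun j => j ≠ i₀), P j := by
    rw [Finset.filter_ne' Finset.univ i₀]
    exact (Finset.add_sum_erase Finset.univ P (Finset.mem_univ i₀)).symm
  have hle : ∑ j ∈ Finset.univ.filter (fun j => j ≠ i₀), P j ≤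
      ∑ j ∈ Finset.univ.filter (fun j => j ≠ i₀), (1 - Real.exp (-ε j)) :=
    Finset.sum_le_sum fun j hj => hOOD j (Finset.mem_filter.mp hj).2
  have hR : 0 ≤ ∑ j ∈ Finset.univ.filter (fun j => j ≠ i₀), P j :=
    Finset.sum_nonneg fun j _ => hP j
  rw [hsplit]
  generalize ∑ j ∈ Finset.univ.filter (fun j => j ≠ i₀), P j = R at *
  generalize ∑ j ∈ Finset.univ.filter (fun j => j ≠ i₀), (1 - Real.exp (-ε j)) = S at *
  have hinv : (P i₀)⁻¹ ≤ Real.exp (ε i₀) := by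
    have h := inv_anti₀ (Real.exp_pos _) hOODi₀
    rwa [Real.exp_neg, inv_inv] at h
  rw [← Real.log_inv, inv_div]
  have hpos : 0 < (P i₀ + R) / P i₀ := by positivity
  have h1 := Real.log_le_sub_one_of_pos hpos
  have h2 : (P i₀ + R) / P i₀ - 1 = (P i₀)⁻¹ * R := by
    field_simp
    ring
  have h3 : (P i₀)⁻¹ * R ≤ Real.exp (ε i₀) * S :=
    mul_le_mul hinv hle hR (Real.exp_pos _).le
  linarith
end

section
/- Let t ≥ 1, let w, τ : Fin t → ℝ satisfy 0 < w i and 0 < τ i for all i, and let γ : Fin t → ℝ satisfy γ i > 0 for all i and ∑_i γ i = 1. Then −log(∑_i w i · τ i) ≤ ∑_i γ i · (−log(w i)) + ∑_i γ i · (−log(τ i)) + (−∑_i γ i · log(γ i)); that is, the domain-incremental cross-entropy is bounded by the γ-weighted WTP cross-entropies plus the γ-weighted TII cross-entropy plus the Shannon entropy H(γ) = −∑_i γ i log(γ i). -/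
open Real Finset

/-- DIL pointwise decomposition: the domain-incremental cross-entropy
−log(∑ i, w i · τ i) is bounded by the γ-weighted WTP cross-entropies plus the
γ-weighted TII cross-entropy plus the Shannon entropy H(γ). -/
theorem dil_pointwise_decomposition
    (t : ℕ) (ht : 1 ≤ t) (w τ γ : Fin t → ℝ)
    (hw : ∀ i, 0 < w i) (hτ : ∀ i, 0 < τ i)
    (hγ : ∀ i, 0 < γ i) (hγsum : ∑ i, γ i = 1) :
    -Real.log (∑ i, w i * τ i) ≤
      (∑ i, γ i * (-Real.log (w i))) + (∑ i, γ i * (-Real.log (τ i))) +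
        (-∑ i, γ i * Real.log (γ i)) := by
  have hγ1 : ∀ i, γ i ≤ 1 := fun i => by
    rw [← hγsum]
    exact Finset.single_le_sum (fun j _ => (hγ j).le) (Finset.mem_univ i)
  have hne : (Finset.univ : Finset (Fin t)).Nonempty := ⟨⟨0, ht⟩, Finset.mem_univ _⟩
  have hJ := strictConcaveOn_log_Ioi.concaveOn.le_map_sum (t := Finset.univ) (w := γ)
    (p := fun i => w i * τ i) (fun i _ => (hγ i).le) hγsum
    (fun i _ => Set.mem_Ioi.mpr (mul_pos (hw i) (hτ i)))
  simp only [smul_eq_mul] at hJ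
  have hpos : 0 < ∑ i, γ i * (w i * τ i) :=
    Finset.sum_pos (fun i _ => mul_pos (hγ i) (mul_pos (hw i) (hτ i))) hne
  have hle : ∑ i, γ i * (w i * τ i) ≤ ∑ i, w i * τ i :=
    Finset.sum_le_sum fun i _ =>
      mul_le_of_le_one_left (mul_pos (hw i) (hτ i)).le (hγ1 i)
  have hlog := Real.log_le_log hpos hle
  have hH : ∑ i, γ i * Real.log (γ i) ≤ 0 :=
    Finset.sum_nonpos fun i _ =>
      mul_nonpos_of_nonneg_of_nonpos (hγ i).le (Real.log_nonpos (hγ i).le (hγ1 i))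
  have hsplit : ∑ i, γ i * Real.log (w i * τ i) =
      ∑ i, γ i * Real.log (w i) + ∑ i, γ i * Real.log (τ i) := by
    rw [← Finset.sum_add_distrib]
    refine Finset.sum_congr rfl fun i _ => ?_
    rw [Real.log_mul (hw i).ne' (hτ i).ne']
    ring
  simp only [mul_neg, Finset.sum_neg_distrib]
  linarith
end

section
/- Fix t ≥ 1, a ground-truth task index ī ∈ Fin t, reals w, a with 0 < w ≤ 1 and 0 < a ≤ 1, OOD probabilities P : Fin t → ℝ and thresholds ε : Fin t → ℝ. Define the TII probability τ = P ī / ∑_j P j. Assume 0 < P ī, 0 ≤ P j for all j, −log w ≤ δ, −log a ≤ η, exp(−ε ī) ≤ P ī, and P j ≤ 1 − exp(−ε j) for every j ≠ ī. Then max{−log(w · τ), −log a} ≤ max{δ + exp(ε ī) · ∑_{j ≠ ī} (1 − exp(−ε j)), η}. -/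
open Real Finset

/-- Theorem (CIL with OOD, sufficiency, pointwise): with TII probability
τ = P i₀ / ∑ j, P j defined from OOD detectors, if −log w ≤ δ, −log a ≤ η and
the OOD cross-entropies are bounded by ε j, then the pointwise loss error
max{−log(w·τ), −log a} ≤ max{δ + exp(ε i₀) · ∑_{j ≠ i₀}(1 − exp(−ε j)), η}. -/
theorem cil_ood_sufficiency
    (t : ℕ) (ht : 1 ≤ t) (i₀ : Fin t) (w a : ℝ) (P ε : Fin t → ℝ) (δ η : ℝ)
    (hw : 0 < w ∧ w ≤ 1) (ha : 0 < a ∧ a ≤ 1)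
    (hPi₀ : 0 < P i₀) (hP : ∀ j, 0 ≤ P j)
    (hwB : -Real.log w ≤ δ) (haB : -Real.log a ≤ η)
    (hOODi₀ : Real.exp (-ε i₀) ≤ P i₀)
    (hOOD : ∀ j, j ≠ i₀ → P j ≤ 1 - Real.exp (-ε j)) :
    max (-Real.log (w * (P i₀ / ∑ j, P j))) (-Real.log a) ≤
      max (δ + Real.exp (ε i₀) *
        ∑ j ∈ Finset.univ.filter (fun j => j ≠ i₀), (1 - Real.exp (-ε j))) η := by
  apply max_le_max _ haB
  have hsplit : ∑ j, P j = P i₀ + ∑ j ∈ Finset.univ.filter (fun j => j ≠ i₀), P j := by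
    rw [Finset.filter_ne' Finset.univ i₀]
    exact (Finset.add_sum_erase Finset.univ P (Finset.mem_univ i₀)).symm
  have hR0 : 0 ≤ ∑ j ∈ Finset.univ.filter (fun j => j ≠ i₀), P j :=
    Finset.sum_nonneg fun j _ => hP j
  have hRle : ∑ j ∈ Finset.univ.filter (fun j => j ≠ i₀), P j ≤
      ∑ j ∈ Finset.univ.filter (fun j => j ≠ i₀), (1 - Real.exp (-ε j)) :=
    Finset.sum_le_sum fun j hj => hOOD j (Finset.mem_filter.mp hj).2
  rw [hsplit]
  generalize ∑ j ∈ Finset.univ.filter (fun j => j ≠ i₀), P j = R at *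
  generalize ∑ j ∈ Finset.univ.filter (fun j => j ≠ i₀), (1 - Real.exp (-ε j)) = Q at *
  have hS : 0 < P i₀ + R := by linarith
  rw [Real.log_mul hw.1.ne' (div_pos hPi₀ hS).ne']
  have h1 : Real.log ((P i₀ + R) / P i₀) ≤ (P i₀ + R) / P i₀ - 1 :=
    Real.log_le_sub_one_of_pos (div_pos hS hPi₀)
  have h2 : Real.log (P i₀ / (P i₀ + R)) = - Real.log ((P i₀ + R) / P i₀) := by
    rw [← Real.log_inv, inv_div]
  have h3 : (P i₀ + R) / P i₀ - 1 = (P i₀)⁻¹ * R := by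
    field_simp
    ring
  have h4 : (P i₀)⁻¹ ≤ Real.exp (ε i₀) := by
    have := inv_anti₀ (Real.exp_pos _) hOODi₀
    rwa [Real.exp_neg, inv_inv] at this
  have h5 : (P i₀)⁻¹ * R ≤ Real.exp (ε i₀) * Q :=
    mul_le_mul h4 hRle hR0 (Real.exp_pos _).le
  linarith
end

section
/- Fix t ≥ 1, a ground-truth task index ī ∈ Fin t, reals w, a with 0 < w ≤ 1 and 0 < a ≤ 1, and OOD probabilities P : Fin t → ℝ with 0 < P j ≤ 1 for all j and 1 ≤ ∑_j P j. Define the TII probability τ = P ī / ∑_j P j. If max{−log(w · τ), −log a} ≤ ξ, then −log w ≤ ξ, −log τ ≤ ξ, −log a ≤ ξ, and the ground-truth OOD cross-entropy satisfies −log(P ī) ≤ ξ. -/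
open Real Finset

/-- Theorem (CIL with OOD, necessity, pointwise): with TII probability
τ = P i₀ / ∑ j, P j, if the pointwise loss error max{−log(w·τ), −log a} ≤ ξ,
then the WTP, TII, TAP and ground-truth OOD cross-entropies are each at most ξ. -/
theorem cil_ood_necessity
    (t : ℕ) (ht : 1 ≤ t) (i₀ : Fin t) (w a : ℝ) (P : Fin t → ℝ) (ξ : ℝ)
    (hw : 0 < w ∧ w ≤ 1) (ha : 0 < a ∧ a ≤ 1)
    (hP : ∀ j, 0 < P j ∧ P j ≤ 1) (hsum : 1 ≤ ∑ j, P j)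
    (hL : max (-Real.log (w * (P i₀ / ∑ j, P j))) (-Real.log a) ≤ ξ) :
    -Real.log w ≤ ξ ∧
      -Real.log (P i₀ / ∑ j, P j) ≤ ξ ∧
      -Real.log a ≤ ξ ∧
      -Real.log (P i₀) ≤ ξ := by
  obtain ⟨h1, h2⟩ := max_le_iff.mp hL
  have hS : 0 < ∑ j, P j := by linarith
  have hi := (hP i₀).1
  have hle : P i₀ ≤ ∑ j, P j :=
    Finset.single_le_sum (f := P) (fun j _ => (hP j).1.le) (Finset.mem_univ i₀)
  have hlw : Real.log w ≤ 0 := Real.log_nonpos hw.1.le hw.2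
  have hlS : 0 ≤ Real.log (∑ j, P j) := Real.log_nonneg hsum
  have hlog := Real.log_le_log hi hle
  have hd : Real.log (P i₀ / ∑ j, P j) = Real.log (P i₀) - Real.log (∑ j, P j) :=
    Real.log_div hi.ne' hS.ne'
  rw [Real.log_mul hw.1.ne' (div_pos hi hS).ne'] at h1
  refine ⟨?_, ?_, h2, ?_⟩ <;> linarith
end
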